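/- arXiv:2409.08404 — 4 statements merged into one kernel-verified Lean document; each statement's English description precedes it below -/
import Mathlib

section
/- Let m ∈ ℕ, T, μ > 0, and let Z : [0,∞) → ℝ^{m×m} be locally integrable and satisfy, for every unit vector v ∈ ℝ^m and every t ≥ 0, ∫_t^{t+T} ‖Z(τ)v‖² dτ ≥ μ. Then for every t ≥ 0 and every x ∈ ℝ^m (for which the improper integral converges), ∫_t^{∞} e^{t−τ} ‖Z(τ)x‖² dτ ≥ ∫_t^{t+T} e^{t−τ} ‖Z(τ)x‖² dτ ≥ e^{−T} μ ‖x‖². Consequently the functional V₃(t, x) := −∫_t^{∞} e^{t−τ} ‖Z(τ)x‖² dτ satisfies V₃(t, x) ≤ −e^{−T} μ ‖x‖² for all t ≥ 0 and x ∈ ℝ^m. -/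
open MeasureTheory Set

/-- `M *ᵥ x` as a map between Euclidean spaces (so that `‖·‖` is the Euclidean norm). -/
noncomputable def mulVecE {n m : ℕ} (M : Matrix (Fin n) (Fin m) ℝ)
    (x : EuclideanSpace ℝ (Fin m)) : EuclideanSpace ℝ (Fin n) :=
  (WithLp.equiv 2 (Fin n → ℝ)).symm (M.mulVec ((WithLp.equiv 2 (Fin m → ℝ)) x))

/-- `mulVecE M` is absolutely homogeneous with respect to the Euclidean norm. -/
theorem norm_mulVecE_smul {n m : ℕ} (M : Matrix (Fin n) (Fin m) ℝ) (c : ℝ)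
    (x : EuclideanSpace ℝ (Fin m)) : ‖mulVecE M (c • x)‖ = |c| * ‖mulVecE M x‖ := by
  have h : mulVecE M (c • x) = c • mulVecE M x := by
    simp [mulVecE, Matrix.mulVec_smul]
  rw [h, norm_smul, Real.norm_eq_abs]

/-- A lower bound on unit vectors for the excitation integral extends to all vectors by
homogeneity. -/
theorem mul_sq_norm_le_integral_sq_norm_mulVecE {n m : ℕ} {Z : ℝ → Matrix (Fin n) (Fin m) ℝ}
    {a b μ : ℝ} (h : ∀ v : EuclideanSpace ℝ (Fin m), ‖v‖ = 1 →
      μ ≤ ∫ τ in a..b, ‖mulVecE (Z τ) v‖ ^ 2)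
    (x : EuclideanSpace ℝ (Fin m)) :
    μ * ‖x‖ ^ 2 ≤ ∫ τ in a..b, ‖mulVecE (Z τ) x‖ ^ 2 := by
  rcases eq_or_ne x 0 with rfl | hx
  · simp [mulVecE]
  have hx' : ‖x‖ ≠ 0 := norm_ne_zero_iff.mpr hx
  have hv := h (‖x‖⁻¹ • x) (by simp [norm_smul, hx'])
  simp only [norm_mulVecE_smul, mul_pow, sq_abs, intervalIntegral.integral_const_mul] at hv
  calc μ * ‖x‖ ^ 2
      ≤ (‖x‖⁻¹ ^ 2 * ∫ τ in a..b, ‖mulVecE (Z τ) x‖ ^ 2) * ‖x‖ ^ 2 := by gcongr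
    _ = ∫ τ in a..b, ‖mulVecE (Z τ) x‖ ^ 2 := by field_simp

/-- the exponentially weighted persistency-of-excitation bound (corrected (v3b)). -/
theorem stmt4 (m : ℕ) (T μ : ℝ) (hT : 0 < T) (hμ : 0 < μ)
    (Z : ℝ → Matrix (Fin m) (Fin m) ℝ)
    (hloc : ∀ x : EuclideanSpace ℝ (Fin m),
      LocallyIntegrable (fun τ => ‖mulVecE (Z τ) x‖ ^ 2) volume)
    (hPE : ∀ v : EuclideanSpace ℝ (Fin m), ‖v‖ = 1 → ∀ t ≥ (0:ℝ),
      μ ≤ ∫ τ in t..(t + T), ‖mulVecE (Z τ) v‖ ^ 2)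
    (t : ℝ) (ht : 0 ≤ t) (x : EuclideanSpace ℝ (Fin m))
    (hconv : IntegrableOn (fun τ => Real.exp (t - τ) * ‖mulVecE (Z τ) x‖ ^ 2) (Ici t)) :
    (∫ τ in t..(t + T), Real.exp (t - τ) * ‖mulVecE (Z τ) x‖ ^ 2)
        ≤ (∫ τ in Ici t, Real.exp (t - τ) * ‖mulVecE (Z τ) x‖ ^ 2)
    ∧ Real.exp (-T) * μ * ‖x‖ ^ 2
        ≤ (∫ τ in t..(t + T), Real.exp (t - τ) * ‖mulVecE (Z τ) x‖ ^ 2)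
    ∧ (-(∫ τ in Ici t, Real.exp (t - τ) * ‖mulVecE (Z τ) x‖ ^ 2))
        ≤ -(Real.exp (-T) * μ * ‖x‖ ^ 2) := by
  have htT : t ≤ t + T := by linarith
  have htail : (∫ τ in t..(t + T), Real.exp (t - τ) * ‖mulVecE (Z τ) x‖ ^ 2)
      ≤ ∫ τ in Ici t, Real.exp (t - τ) * ‖mulVecE (Z τ) x‖ ^ 2 := by
    rw [intervalIntegral.integral_of_le htT]
    exact setIntegral_mono_set hconv (ae_of_all _ fun τ => by positivity)
      (ae_of_all _ fun τ hτ => hτ.1.le)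
  have hlower : Real.exp (-T) * μ * ‖x‖ ^ 2
      ≤ ∫ τ in t..(t + T), Real.exp (t - τ) * ‖mulVecE (Z τ) x‖ ^ 2 := by
    calc Real.exp (-T) * μ * ‖x‖ ^ 2
        ≤ Real.exp (-T) * ∫ τ in t..(t + T), ‖mulVecE (Z τ) x‖ ^ 2 := by
          rw [mul_assoc]
          gcongr
          exact mul_sq_norm_le_integral_sq_norm_mulVecE (fun v hv => hPE v hv t ht) x
      _ = ∫ τ in t..(t + T), Real.exp (-T) * ‖mulVecE (Z τ) x‖ ^ 2 :=
          (intervalIntegral.integral_const_mul _ _).symm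
      _ ≤ ∫ τ in t..(t + T), Real.exp (t - τ) * ‖mulVecE (Z τ) x‖ ^ 2 := by
          refine intervalIntegral.integral_mono_on htT ?_ ?_ fun τ hτ => ?_
          · exact (((hloc x).integrableOn_isCompact isCompact_uIcc).intervalIntegrable).const_mul _
          · exact (intervalIntegrable_iff_integrableOn_Ioc_of_le htT).mpr
              (hconv.mono_set fun τ hτ => hτ.1.le)
          · gcongr
            linarith [hτ.2]
  exact ⟨htail, hlower, neg_le_neg (hlower.trans htail)⟩
end

section
/- Let n, m ∈ ℕ, c, c₁, σ₁ > 0, let L_e ∈ ℝ^{n×n}, B ∈ ℝ^{n×m} be constant matrices with zᵀ(c₁I + cL_e)z ≥ c₁′‖z‖² for all z ∈ ℝⁿ and some c₁′ > 0. Let w̄ : [0,∞) → ℝ^m be differentiable with ‖w̄(t)‖ ≤ w_d and ‖w̄′(t)‖ ≤ w_d′, and let z̃ : [0,∞) → ℝⁿ, w̃ : [0,∞) → ℝ^m be differentiable with z̃′(t) = g(t) − (c₁I + cL_e) z̃(t) − c B M(t) w̃(t) and w̃′(t) = c M(t)ᵀ Bᵀ z̃(t) + w̄′(t) + σ₁(w̄(t)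 − w̃(t)), where ‖g(t)‖ ≤ L_f ‖z̃(t)‖ and M : [0,∞) → ℝ^{m×m}. Then V₁(t) := ½‖z̃(t)‖² + ½‖w̃(t)‖² satisfies, for all t ≥ 0, V₁′(t) ≤ −(c₁′ − L_f)‖z̃(t)‖² − σ₁‖w̃(t)‖² + ‖w̃(t)‖(w_d′ + σ₁ w_d). Moreover, for any δ > 0 with σ₁′ := σ₁ − (σ₁ + 1)/(2δ²) > 0 and c₁′ − L_f > 0, setting c₁″ := min{c₁′ − L_f, σ₁′} and d := (δ²/2)(σ₁ w_d² + w_d′²), one has V₁′(t) ≤ −2c₁″ V₁(t) + d for all t ≥ 0. -/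
open RealInnerProductSpace Matrix

/-- The transpose is the adjoint for the Euclidean inner product. -/
theorem inner_mulVecE_transpose {n m : ℕ} (A : Matrix (Fin n) (Fin m) ℝ)
    (x : EuclideanSpace ℝ (Fin m)) (y : EuclideanSpace ℝ (Fin n)) :
    ⟪x, mulVecE Aᵀ y⟫ = ⟪y, mulVecE A x⟫ := by
  simp only [mulVecE, EuclideanSpace.inner_eq_star_dotProduct, WithLp.equiv_apply,
    WithLp.equiv_symm_apply, star_trivial]
  rw [Matrix.mulVec_transpose, ← Matrix.dotProduct_mulVec, dotProduct_comm]

/-- Young's inequality with a weight `δ`. -/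
theorem mul_le_sq_div_add_mul_sq {δ : ℝ} (hδ : 0 < δ) (a b : ℝ) :
    a * b ≤ a ^ 2 / (2 * δ ^ 2) + δ ^ 2 / 2 * b ^ 2 := by
  have h : a ^ 2 / (2 * δ ^ 2) + δ ^ 2 / 2 * b ^ 2 - a * b = (a / δ - δ * b) ^ 2 / 2 := by
    field_simp
    ring
  have := sq_nonneg (a / δ - δ * b)
  linarith

/-- the Lyapunov derivative bound (231) for the σ-modified update law,
together with the dissipation inequality obtained via Young's inequality. -/
theorem stmt7 (n m : ℕ) (c c₁ σ₁ c₁' L_f w_d w_d' : ℝ)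
    (hc : 0 < c) (hc₁ : 0 < c₁) (hσ₁ : 0 < σ₁) (hc₁' : 0 < c₁') (hLf : 0 ≤ L_f)
    (L_e : Matrix (Fin n) (Fin n) ℝ) (B : Matrix (Fin n) (Fin m) ℝ)
    (hquad : ∀ z : EuclideanSpace ℝ (Fin n),
      c₁' * ‖z‖ ^ 2 ≤ ⟪z, mulVecE (c₁ • (1 : Matrix (Fin n) (Fin n) ℝ) + c • L_e) z⟫)
    (wbar wbar' : ℝ → EuclideanSpace ℝ (Fin m))
    (hwder : ∀ t : ℝ, HasDerivAt wbar (wbar' t) t)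
    (hwb : ∀ t ≥ (0:ℝ), ‖wbar t‖ ≤ w_d ∧ ‖wbar' t‖ ≤ w_d')
    (M : ℝ → Matrix (Fin m) (Fin m) ℝ)
    (zt : ℝ → EuclideanSpace ℝ (Fin n)) (wt : ℝ → EuclideanSpace ℝ (Fin m))
    (g : ℝ → EuclideanSpace ℝ (Fin n))
    (hg : ∀ t : ℝ, ‖g t‖ ≤ L_f * ‖zt t‖)
    (hzode : ∀ t : ℝ, HasDerivAt zt
      (g t - mulVecE (c₁ • (1 : Matrix (Fin n) (Fin n) ℝ) + c • L_e) (zt t)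
        - c • mulVecE B (mulVecE (M t) (wt t))) t)
    (hwode : ∀ t : ℝ, HasDerivAt wt
      (c • mulVecE (M t)ᵀ (mulVecE Bᵀ (zt t)) + wbar' t + σ₁ • (wbar t - wt t)) t) :
    ∀ t ≥ (0:ℝ), ∃ v : ℝ,
      HasDerivAt (fun s => (1 / 2) * ‖zt s‖ ^ 2 + (1 / 2) * ‖wt s‖ ^ 2) v t
      ∧ v ≤ -(c₁' - L_f) * ‖zt t‖ ^ 2 - σ₁ * ‖wt t‖ ^ 2 + ‖wt t‖ * (w_d' + σ₁ * w_d)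
      ∧ ∀ δ : ℝ, 0 < δ → 0 < σ₁ - (σ₁ + 1) / (2 * δ ^ 2) → 0 < c₁' - L_f →
          v ≤ -2 * min (c₁' - L_f) (σ₁ - (σ₁ + 1) / (2 * δ ^ 2))
                * ((1 / 2) * ‖zt t‖ ^ 2 + (1 / 2) * ‖wt t‖ ^ 2)
              + (δ ^ 2 / 2) * (σ₁ * w_d ^ 2 + w_d' ^ 2) := by
  intro t ht
  obtain ⟨hwd, hwd'⟩ := hwb t ht
  have hV := ((hzode t).norm_sq.const_mul (1 / 2)).add ((hwode t).norm_sq.const_mul (1 / 2))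
  have hcross : ⟪wt t, mulVecE (M t)ᵀ (mulVecE Bᵀ (zt t))⟫ =
      ⟪zt t, mulVecE B (mulVecE (M t) (wt t))⟫ := by
    rw [inner_mulVecE_transpose, real_inner_comm, inner_mulVecE_transpose]
  have hbound := calc
    1 / 2 * (2 * ⟪zt t, g t - mulVecE (c₁ • (1 : Matrix (Fin n) (Fin n) ℝ) + c • L_e) (zt t)
          - c • mulVecE B (mulVecE (M t) (wt t))⟫)
        + 1 / 2 * (2 * ⟪wt t, c • mulVecE (M t)ᵀ (mulVecE Bᵀ (zt t)) + wbar' t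
          + σ₁ • (wbar t - wt t)⟫)
      = ⟪zt t, g t⟫
          - ⟪zt t, mulVecE (c₁ • (1 : Matrix (Fin n) (Fin n) ℝ) + c • L_e) (zt t)⟫
          + ⟪wt t, wbar' t⟫ + σ₁ * ⟪wt t, wbar t⟫ - σ₁ * ‖wt t‖ ^ 2 := by
        simp only [inner_sub_right, inner_add_right, inner_smul_right, hcross,
          real_inner_self_eq_norm_sq]
        ring
    _ ≤ ‖zt t‖ * (L_f * ‖zt t‖) - c₁' * ‖zt t‖ ^ 2
          + ‖wt t‖ * w_d' + σ₁ * (‖wt t‖ * w_d) - σ₁ * ‖wt t‖ ^ 2 := by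
        gcongr
        · exact (real_inner_le_norm _ _).trans (by gcongr; exact hg t)
        · exact hquad _
        · exact (real_inner_le_norm _ _).trans (by gcongr)
        · exact (real_inner_le_norm _ _).trans (by gcongr)
    _ = -(c₁' - L_f) * ‖zt t‖ ^ 2 - σ₁ * ‖wt t‖ ^ 2 + ‖wt t‖ * (w_d' + σ₁ * w_d) := by ring
  refine ⟨_, hV, hbound, fun δ hδ _ _ => hbound.trans ?_⟩
  have hYoung := mul_le_sq_div_add_mul_sq hδ ‖wt t‖ w_d
  have hYoung' := mul_le_sq_div_add_mul_sq hδ ‖wt t‖ w_d'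
  have hσYoung := mul_le_mul_of_nonneg_left hYoung hσ₁.le
  have hz := mul_le_mul_of_nonneg_right
    (min_le_left (c₁' - L_f) (σ₁ - (σ₁ + 1) / (2 * δ ^ 2))) (sq_nonneg ‖zt t‖)
  have hw := mul_le_mul_of_nonneg_right
    (min_le_right (c₁' - L_f) (σ₁ - (σ₁ + 1) / (2 * δ ^ 2))) (sq_nonneg ‖wt t‖)
  have hsplit : (σ₁ - (σ₁ + 1) / (2 * δ ^ 2)) * ‖wt t‖ ^ 2 = σ₁ * ‖wt t‖ ^ 2
      - σ₁ * (‖wt t‖ ^ 2 / (2 * δ ^ 2)) - ‖wt t‖ ^ 2 / (2 * δ ^ 2) := by ring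
  linarith
end

section
/- Let n ∈ ℕ, and let f₀, Δf : [0,∞) × ℝⁿ → ℝⁿ be such that the perturbed vector field is f := f₀ + Δf, where the perturbation has the block form Δf(t, ξ) = (g(t, ξ), p(t)) with ‖g(t, ξ)‖ ≤ L_f ‖ξ₁‖ for ξ = (ξ₁, ξ₂) and ‖p(t)‖ ≤ w_d′ for all t. Let V : [0,∞) × ℝⁿ → [0,∞) be C¹ with ‖∂V/∂ξ(t, ξ)‖ ≤ β₃‖ξ‖ and ∂V/∂t + (∂V/∂ξ)·f₀(t, ξ) ≤ −β₄‖ξ‖² for all (t, ξ), where β₃, β₄ > 0. Let V₁(ξ) := ½‖ξ‖² satisfy, along the perturbed field, ∂V₁/∂ξ · f(t, ξ) ≤ −c₁′‖ξ₁‖² + ‖ξ₂‖‖p(t)‖ with c₁′ > 0. Then for every δ > 0 with c₁′ − L_f²/δ² > 0, the function V′ := V + V₁ satisfies along the perturbed field, for all (t, ξ): ∂V′/∂t + (∂V′/∂ξ)·f(t, ξ) ≤ −β₄′‖ξ‖² + β₅, where β₄′ := β₄ − β₃²δ²/4 − δ²/4 and β₅ := 2w_d′²/δ². In particular, if δ is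 chosen small enough that β₄′ > 0, then V′ is a Lyapunov function certifying global ultimate boundedness with ultimate bound on ‖ξ‖ equal to √(β₅/β₄′). -/
open RealInnerProductSpace

noncomputable section

variable (n₁ n₂ : ℕ)

/-- The composite state space `ℝ^{n₁} × ℝ^{n₂}` with the Euclidean (ℓ²) product norm. -/
abbrev CompState (n₁ n₂ : ℕ) :=
  WithLp 2 (EuclideanSpace ℝ (Fin n₁) × EuclideanSpace ℝ (Fin n₂))

/-- Build a composite state from its two blocks. -/
def blockMk {n₁ n₂ : ℕ} (a : EuclideanSpace ℝ (Fin n₁)) (b : EuclideanSpace ℝ (Fin n₂)) :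
    CompState n₁ n₂ :=
  (WithLp.equiv 2 (EuclideanSpace ℝ (Fin n₁) × EuclideanSpace ℝ (Fin n₂))).symm (a, b)

/-- First block `ξ₁` of a composite state. -/
def fstBlock {n₁ n₂ : ℕ} (x : CompState n₁ n₂) : EuclideanSpace ℝ (Fin n₁) :=
  ((WithLp.equiv 2 (EuclideanSpace ℝ (Fin n₁) × EuclideanSpace ℝ (Fin n₂))) x).1

/-- Second block `ξ₂` of a composite state. -/
def sndBlock {n₁ n₂ : ℕ} (x : CompState n₁ n₂) : EuclideanSpace ℝ (Fin n₂) :=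
  ((WithLp.equiv 2 (EuclideanSpace ℝ (Fin n₁) × EuclideanSpace ℝ (Fin n₂))) x).2

theorem norm_sq_eq_blocks {n₁ n₂ : ℕ} (x : CompState n₁ n₂) :
    ‖x‖ ^ 2 = ‖fstBlock x‖ ^ 2 + ‖sndBlock x‖ ^ 2 :=
  WithLp.prod_norm_sq_eq_of_L2 x

theorem norm_sq_blockMk {n₁ n₂ : ℕ} (a : EuclideanSpace ℝ (Fin n₁))
    (b : EuclideanSpace ℝ (Fin n₂)) : ‖blockMk a b‖ ^ 2 = ‖a‖ ^ 2 + ‖b‖ ^ 2 :=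
  norm_sq_eq_blocks (blockMk a b)

/-- Young's inequality with weight `δ`. -/
theorem mul_le_weighted_sq_add_sq_div {δ : ℝ} (hδ : 0 < δ) (a b : ℝ) :
    a * b ≤ δ ^ 2 * a ^ 2 / 4 + b ^ 2 / δ ^ 2 := by
  have h : δ ^ 2 * a ^ 2 / 4 + b ^ 2 / δ ^ 2 - a * b = (δ * a / 2 - b / δ) ^ 2 := by
    field_simp
    ring
  linarith [sq_nonneg (δ * a / 2 - b / δ)]

/-- the perturbation inequality (n331) of Proposition 1: a converse-Lyapunov
function `V` for the unperturbed field `f₀`, combined with `V₁ = ½‖ξ‖²` and Young's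
inequality, absorbs the perturbation `Δf = (g, p)` into a strict dissipation inequality. -/
theorem stmt8 (n₁ n₂ : ℕ) (L_f w_d' c₁' β₃ β₄ : ℝ)
    (hLf : 0 ≤ L_f) (hwd' : 0 ≤ w_d') (hc₁' : 0 < c₁') (hβ₃ : 0 < β₃) (hβ₄ : 0 < β₄)
    (f₀ f : ℝ → CompState n₁ n₂ → CompState n₁ n₂)
    (g : ℝ → CompState n₁ n₂ → EuclideanSpace ℝ (Fin n₁))
    (p : ℝ → EuclideanSpace ℝ (Fin n₂))
    (hf : ∀ t ξ, f t ξ = f₀ t ξ + blockMk (g t ξ) (p t))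
    (hgb : ∀ t ξ, ‖g t ξ‖ ≤ L_f * ‖fstBlock ξ‖)
    (hpb : ∀ t : ℝ, ‖p t‖ ≤ w_d')
    (V : ℝ × CompState n₁ n₂ → ℝ)
    (D : ℝ × CompState n₁ n₂ → (ℝ × CompState n₁ n₂ →L[ℝ] ℝ))
    (hVpos : ∀ q, 0 ≤ V q)
    (hVderiv : ∀ q, HasFDerivAt V (D q) q)
    (hDx : ∀ t ξ, ‖(D (t, ξ)).comp
      (ContinuousLinearMap.inr ℝ ℝ (CompState n₁ n₂))‖ ≤ β₃ * ‖ξ‖)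
    (hdiss : ∀ t ξ, D (t, ξ) (1, f₀ t ξ) ≤ -β₄ * ‖ξ‖ ^ 2)
    (hV₁ : ∀ t ξ, ⟪ξ, f t ξ⟫ ≤ -c₁' * ‖fstBlock ξ‖ ^ 2 + ‖sndBlock ξ‖ * ‖p t‖) :
    ∀ δ > (0:ℝ), 0 < c₁' - L_f ^ 2 / δ ^ 2 →
      ∀ (t : ℝ) (ξ : CompState n₁ n₂),
        D (t, ξ) (1, f t ξ) + ⟪ξ, f t ξ⟫
          ≤ -(β₄ - β₃ ^ 2 * δ ^ 2 / 4 - δ ^ 2 / 4) * ‖ξ‖ ^ 2 + 2 * w_d' ^ 2 / δ ^ 2 := by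
  intro δ hδ hc t ξ
  set a := ‖fstBlock ξ‖ with ha
  set b := ‖sndBlock ξ‖ with hb
  set Δ : CompState n₁ n₂ := blockMk (g t ξ) (p t) with hΔ
  have hsplit : D (t, ξ) (1, f t ξ) = D (t, ξ) (1, f₀ t ξ) +
      (D (t, ξ)).comp (ContinuousLinearMap.inr ℝ ℝ (CompState n₁ n₂)) Δ := by
    rw [hf, ContinuousLinearMap.comp_apply, ContinuousLinearMap.inr_apply, ← map_add]
    simp [hΔ]
  have hpert : (D (t, ξ)).comp (ContinuousLinearMap.inr ℝ ℝ (CompState n₁ n₂)) Δ ≤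
      (β₃ * ‖ξ‖) * ‖Δ‖ :=
    (le_abs_self _).trans (ContinuousLinearMap.le_of_opNorm_le _ (hDx t ξ) Δ)
  have hΔsq : ‖Δ‖ ^ 2 ≤ L_f ^ 2 * a ^ 2 + w_d' ^ 2 := by
    rw [hΔ, norm_sq_blockMk, ← mul_pow]
    gcongr
    · exact hgb t ξ
    · exact hpb t
  have hΔdiv : ‖Δ‖ ^ 2 / δ ^ 2 ≤ L_f ^ 2 / δ ^ 2 * a ^ 2 + w_d' ^ 2 / δ ^ 2 := by
    calc ‖Δ‖ ^ 2 / δ ^ 2 ≤ (L_f ^ 2 * a ^ 2 + w_d' ^ 2) / δ ^ 2 := by gcongr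
      _ = _ := by ring
  have hbp : b * ‖p t‖ ≤ b * w_d' := by
    gcongr
    exact hpb t
  have hbξ : δ ^ 2 * b ^ 2 / 4 ≤ δ ^ 2 * ‖ξ‖ ^ 2 / 4 := by
    have : b ^ 2 ≤ ‖ξ‖ ^ 2 := by
      rw [norm_sq_eq_blocks ξ]
      exact le_add_of_nonneg_left (sq_nonneg _)
    gcongr
  have hca := mul_nonneg hc.le (sq_nonneg a)
  have hrhs : 2 * w_d' ^ 2 / δ ^ 2 = w_d' ^ 2 / δ ^ 2 + w_d' ^ 2 / δ ^ 2 := by ring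
  rw [hsplit, hrhs]
  linarith [mul_le_weighted_sq_add_sq_div hδ (β₃ * ‖ξ‖) ‖Δ‖,
    mul_le_weighted_sq_add_sq_div hδ b w_d', hdiss t ξ, hV₁ t ξ]

end
end

section
/- Let c > 0, M ≥ 0, t ≥ 0, S > 0 and μ > 0. Let ρ : ℝ → ℝ be differentiable with |ρ(τ)| ≤ M for all τ, and let g, h : ℝ → ℝ be continuous and nonnegative with ρ′(τ) ≤ −g(τ) + c·h(τ) for all τ ∈ [t, t+S]. If ∫_t^{t+S} g(τ) dτ ≥ μ, then ∫_t^{t+S} h(τ) dτ ≥ (μ − 2M)/c. Moreover, if μ > 2M, then by the Cauchy–Schwarz inequality ∫_t^{t+S} h(τ)² dτ ≥ (μ − 2M)²/(c² S) > 0. -/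
/-- Cauchy–Schwarz inequality against the constant function `1` on a compact interval. -/
theorem sq_intervalIntegral_le_mul_intervalIntegral_sq {a b : ℝ} (hab : a ≤ b) {f : ℝ → ℝ}
    (hf : Continuous f) :
    (∫ x in a..b, f x) ^ 2 ≤ (b - a) * ∫ x in a..b, f x ^ 2 := by
  obtain rfl | hlt := hab.eq_or_lt
  · simp
  set I := ∫ x in a..b, f x
  have hpos : 0 < b - a := sub_pos.2 hlt
  have hnonneg : 0 ≤ ∫ x in a..b, ((b - a) * f x - I) ^ 2 :=
    intervalIntegral.integral_nonneg hab fun x _ => sq_nonneg _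
  have hexpand : ∫ x in a..b, ((b - a) * f x - I) ^ 2 =
      (b - a) * ((b - a) * (∫ x in a..b, f x ^ 2) - I ^ 2) := by
    have hfun : ∀ x, ((b - a) * f x - I) ^ 2 =
        (b - a) ^ 2 * f x ^ 2 - 2 * (b - a) * I * f x + I ^ 2 := fun x => by ring
    simp_rw [hfun]
    rw [intervalIntegral.integral_add
        (Continuous.intervalIntegrable (by fun_prop) _ _) (by simp),
      intervalIntegral.integral_sub
        (Continuous.intervalIntegrable (by fun_prop) _ _)
        (Continuous.intervalIntegrable (by fun_prop) _ _),
      intervalIntegral.integral_const_mul, intervalIntegral.integral_const_mul,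
      intervalIntegral.integral_const, smul_eq_mul]
    change (b - a) ^ 2 * _ - 2 * (b - a) * I * I + _ = _
    ring
  rw [hexpand] at hnonneg
  exact sub_nonneg.1 (nonneg_of_mul_nonneg_right hnonneg hpos)

/-- the key integral estimate of the Appendix Lemma (filtration property):
integrating `ρ' ≤ -g + c·h` over a window where `g` accumulates at least `μ`, using `|ρ| ≤ M`,
gives a lower bound on the accumulated excitation of `h`, and then on `∫ h²` by Cauchy–Schwarz. -/
theorem stmt11 (c M t S μ : ℝ)
    (hc : 0 < c) (hM : 0 ≤ M) (ht : 0 ≤ t) (hS : 0 < S) (hμ : 0 < μ)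
    (ρ g h : ℝ → ℝ) (hρdiff : Differentiable ℝ ρ) (hρb : ∀ τ : ℝ, |ρ τ| ≤ M)
    (hg : Continuous g) (hh : Continuous h)
    (hgpos : ∀ τ : ℝ, 0 ≤ g τ) (hhpos : ∀ τ : ℝ, 0 ≤ h τ)
    (hineq : ∀ τ ∈ Set.Icc t (t + S), deriv ρ τ ≤ -g τ + c * h τ)
    (hint : μ ≤ ∫ τ in t..(t + S), g τ) :
    (μ - 2 * M) / c ≤ (∫ τ in t..(t + S), h τ)
    ∧ (2 * M < μ → (μ - 2 * M) ^ 2 / (c ^ 2 * S) ≤ ∫ τ in t..(t + S), (h τ) ^ 2) := by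
  have hle : t ≤ t + S := by linarith
  have hftc : ρ (t + S) - ρ t ≤ ∫ τ in t..(t + S), (-g τ + c * h τ) :=
    intervalIntegral.sub_le_integral_of_hasDeriv_right_of_le hle hρdiff.continuous.continuousOn
      (fun τ _ => (hρdiff τ).hasDerivAt.hasDerivWithinAt)
      (Continuous.integrableOn_Icc (by fun_prop))
      (fun τ hτ => hineq τ (Set.Ioo_subset_Icc_self hτ))
  rw [intervalIntegral.integral_add (Continuous.intervalIntegrable (by fun_prop) _ _)
    (Continuous.intervalIntegrable (by fun_prop) _ _), intervalIntegral.integral_neg,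
    intervalIntegral.integral_const_mul] at hftc
  have hlower : (μ - 2 * M) / c ≤ ∫ τ in t..(t + S), h τ := by
    rw [div_le_iff₀' hc]
    linarith [(abs_le.1 (hρb (t + S))).1, (abs_le.1 (hρb t)).2]
  refine ⟨hlower, fun hMμ => ?_⟩
  have hnonneg : 0 ≤ (μ - 2 * M) / c := div_nonneg (by linarith) hc.le
  rw [← div_div, ← div_pow, div_le_iff₀' hS]
  calc ((μ - 2 * M) / c) ^ 2 ≤ (∫ τ in t..(t + S), h τ) ^ 2 := by gcongr
    _ ≤ (t + S - t) * ∫ τ in t..(t + S), h τ ^ 2 :=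
      sq_intervalIntegral_le_mul_intervalIntegral_sq hle hh
    _ = S * ∫ τ in t..(t + S), h τ ^ 2 := by rw [add_sub_cancel_left]
end
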